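/- Let G = (V, E) be a finite undirected graph, X ⊆ V, and M ⊆ X. The number of consistent cuts (X1, X2) of G[X] with M ⊆ X1 equals 2^c, where c is the number of connected components of G[X] that contain no vertex of M. -/

import Mathlib

/-- The number of consistent cuts `(X1, X2)` of `G[X]` with `M ⊆ X1` equals `2 ^ c`,
where `c` is the number of connected components of `G[X]` containing no vertex of `M`. -/
theorem stmt2 {V : Type*} [Fintype V] (G : SimpleGraph V) (X M : Set V) (hM : M ⊆ X) :
    Nat.card {p : Set V × Set V //
        p.1 ∪ p.2 = X ∧ p.1 ∩ p.2 = ∅ ∧ M ⊆ p.1 ∧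
        ∀ u v, G.Adj u v → ¬(u ∈ p.1 ∧ v ∈ p.2)} =
      2 ^ Nat.card {C : (G.induce X).ConnectedComponent //
        ∀ v : X, (G.induce X).connectedComponentMk v = C → (v : V) ∉ M} := by
  classical
  let T := {C : (G.induce X).ConnectedComponent //
        ∀ v : X, (G.induce X).connectedComponentMk v = C → (v : V) ∉ M}
  have hcard : Nat.card (Set T) = 2 ^ Nat.card T := by
    haveI : Fintype T := Fintype.ofFinite T
    rw [Nat.card_eq_fintype_card, Nat.card_eq_fintype_card, Fintype.card_set]
  change _ = 2 ^ Nat.card T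
  rw [← hcard]
  let B : Set T → Set V := fun S =>
    {v | ∃ h : v ∈ X, ∃ t ∈ S, t.1 = (G.induce X).connectedComponentMk ⟨v, h⟩}
  have hBX : ∀ S, B S ⊆ X := fun S v hv => hv.1
  symm
  refine Nat.card_congr (Equiv.ofBijective
    (fun S => ⟨(X \ B S, B S), ?_, ?_, ?_, ?_⟩) ⟨?_, ?_⟩)
  · exact Set.diff_union_of_subset (hBX S)
  · exact Set.diff_inter_self
  · rintro v hv
    refine ⟨hM hv, ?_⟩
    rintro ⟨h, t, -, ht⟩
    exact t.2 ⟨v, h⟩ ht.symm hv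
  · rintro u v huv ⟨⟨hu, hu'⟩, ⟨hv, t, htS, ht⟩⟩
    refine hu' ⟨hu, t, htS, ht.trans ?_⟩
    apply SimpleGraph.ConnectedComponent.sound
    apply SimpleGraph.Adj.reachable
    exact huv.symm
  · intro S S' h
    have hB : B S = B S' := congrArg (fun p => p.1.2) h
    have key : ∀ (S : Set T) (t : T) (v : X),
        (G.induce X).connectedComponentMk v = t.1 → (t ∈ S ↔ v.1 ∈ B S) := by
      intro S t v hv
      constructor
      · intro ht
        exact ⟨v.2, t, ht, hv.symm⟩
      · rintro ⟨_, t', ht', e⟩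
        have : t' = t := Subtype.ext (e.trans hv)
        exact this ▸ ht'
    ext t
    obtain ⟨v, hv⟩ := t.1.exists_rep
    rw [key S t v hv, key S' t v hv, hB]
  · rintro ⟨⟨A, C⟩, h1, h2, h3, h4⟩
    simp only at h1 h2 h3 h4
    have hd : ∀ v, v ∈ A → v ∉ C := fun v ha hc => by
      have : v ∈ A ∩ C := ⟨ha, hc⟩
      rw [h2] at this
      exact this
    have hA : ∀ v, v ∈ X → v ∉ C → v ∈ A := fun v hv hc => by
      rw [← h1] at hv
      exact hv.resolve_right hc
    have hCX : C ⊆ X := h1 ▸ Set.subset_union_right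
    have hreach : ∀ u v : X, (G.induce X).Reachable u v → u.1 ∈ C → v.1 ∈ C := by
      rintro u v ⟨w⟩
      induction w with
      | nil => exact id
      | @cons a b c hab _ ih =>
        intro hu
        refine ih ?_
        by_contra hb
        exact h4 b a (SimpleGraph.Adj.symm hab) ⟨hA _ b.2 hb, hu⟩
    let S : Set T := {t | ∃ v : X, (G.induce X).connectedComponentMk v = t.1 ∧ v.1 ∈ C}
    have hS : B S = C := by
      ext v
      constructor
      · rintro ⟨h, t, ⟨w, hw, hwC⟩, ht⟩
        exact hreach w ⟨v, h⟩ (SimpleGraph.ConnectedComponent.exact (hw.trans ht)) hwC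
      · intro hv
        refine ⟨hCX hv, ⟨(G.induce X).connectedComponentMk ⟨v, hCX hv⟩, ?_⟩,
          ⟨⟨v, hCX hv⟩, rfl, hv⟩, rfl⟩
        intro w hw hwM
        exact hd _ (h3 hwM) (hreach _ w (SimpleGraph.ConnectedComponent.exact hw.symm) hv)
    refine ⟨S, Subtype.ext (Prod.ext ?_ hS)⟩
    change X \ B S = A
    rw [hS]
    ext v
    exact ⟨fun h => hA v h.1 h.2, fun h => ⟨h1 ▸ Or.inl h, hd v h⟩⟩
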